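/- Let X be a set of 2d+3 points in ℝ^d. Then X can be partitioned into two disjoint sets X_1 and X_2 such that for every point p ∈ X, the convex hulls conv(X_1 \ {p}) and conv(X_2 \ {p}) have a point in common. -/

import Mathlib

open scoped Classical

/-- signed family -/
noncomputable def sgv {E ι : Type*} [AddCommGroup E] (x : ι → E) (ε : ι → Bool) (i : ι) : E :=
  if ε i then x i else - x i

lemma infDist_lt_of_inner_lt {E : Type*} [NormedAddCommGroup E] [InnerProductSpace ℝ E]
    {K : Set E} (hK : Convex ℝ K) {y q : E} (hy : y ∈ K) (hq : q ∈ K)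
    (h : inner ℝ y q < ‖y‖ ^ 2) : Metric.infDist 0 K < ‖y‖ := by
  set a : ℝ := inner ℝ y (q - y) with ha
  set b : ℝ := ‖q - y‖ ^ 2 with hb
  have ha0 : a < 0 := by
    rw [ha, inner_sub_right, real_inner_self_eq_norm_sq]; linarith
  have hb0 : 0 ≤ b := by positivity
  have hba : 0 < b - a := by linarith
  set t : ℝ := -a / (b - a) with ht
  have ht0 : 0 < t := div_pos (by linarith) hba
  have ht1 : t ≤ 1 := by rw [ht, div_le_one hba]; linarith
  have htb : t * (b - a) = -a := by rw [ht]; field_simp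
  have hmem : y + t • (q - y) ∈ K := hK.add_smul_sub_mem hy hq ⟨ht0.le, ht1⟩
  have hn : ‖y + t • (q - y)‖ ^ 2 = ‖y‖ ^ 2 + 2 * (t * a) + t ^ 2 * b := by
    rw [norm_add_sq_real, inner_smul_right, norm_smul, mul_pow, Real.norm_eq_abs, sq_abs]
  have hlt : ‖y + t • (q - y)‖ < ‖y‖ := by
    apply lt_of_pow_lt_pow_left₀ 2 (norm_nonneg _)
    rw [hn]
    have : 2 * (t * a) + t ^ 2 * b = t * (a + t * a) := by
      have : t * b = -a + t * a := by linarith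
      calc 2 * (t * a) + t ^ 2 * b = t * (2 * a + t * b) := by ring
        _ = _ := by rw [this]; ring
    have h2 : t * (a + t * a) < 0 :=
      mul_neg_of_pos_of_neg ht0 (by nlinarith)
    linarith
  refine lt_of_le_of_lt (Metric.infDist_le_dist_of_mem hmem) ?_
  rwa [dist_zero_left]

/-- The nearest point of a hull lies in the hull of few points. -/
lemma few_points {E ι : Type*} [NormedAddCommGroup E] [InnerProductSpace ℝ E]
    [FiniteDimensional ℝ E] (v : ι → E) (S : Set ι) (y : E)
    (hy : y ∈ convexHull ℝ (v '' S)) (hy0 : y ≠ 0)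
    (hmin : ∀ q ∈ convexHull ℝ (v '' S), ‖y‖ ^ 2 ≤ inner ℝ y q) :
    ∃ F : Finset ι, (F : Set ι) ⊆ S ∧ F.card ≤ Module.finrank ℝ E ∧
      y ∈ convexHull ℝ (v '' F) := by
  obtain ⟨κ, _, z, w, hz, hai, hw, hw1, hsum⟩ := eq_pos_convex_span_of_mem_convexHull hy
  have hzS : ∀ k, ∃ i ∈ S, v i = z k := fun k => hz ⟨k, rfl⟩
  choose g hgS hg using hzS
  have hle : ∀ k, ‖y‖ ^ 2 ≤ inner ℝ y (z k) := fun k => hmin _ (subset_convexHull _ _ (hz ⟨k, rfl⟩))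
  have heq : ∀ k, inner ℝ y (z k) = ‖y‖ ^ 2 := by
    have h1 : ∑ k, w k * (inner ℝ y (z k) - ‖y‖ ^ 2) = 0 := by
      have : inner ℝ y (∑ k, w k • z k) = ‖y‖ ^ 2 := by
        rw [hsum, real_inner_self_eq_norm_sq]
      rw [inner_sum] at this
      simp only [inner_smul_right] at this
      simp only [mul_sub, Finset.sum_sub_distrib, this, ← Finset.sum_mul, hw1]
      ring
    rw [Finset.sum_eq_zero_iff_of_nonneg
      (fun k _ => mul_nonneg (hw k).le (sub_nonneg.2 (hle k)))] at h1
    intro k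
    have := h1 k (Finset.mem_univ k)
    rcases mul_eq_zero.1 this with h | h
    · exact absurd h (hw k).ne'
    · linarith
  have hcard : Fintype.card κ ≤ Module.finrank ℝ E := by
    have h1 := hai.card_le_finrank_succ
    have h2 : vectorSpan ℝ (Set.range z) ≤ (ℝ ∙ y)ᗮ := by
      rw [vectorSpan_def, Submodule.span_le]
      rintro _ ⟨_, ⟨k, rfl⟩, _, ⟨l, rfl⟩, rfl⟩
      rw [SetLike.mem_coe, Submodule.mem_orthogonal_singleton_iff_inner_right]
      simp [inner_sub_right, heq]
    have h3 := Submodule.finrank_mono h2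
    have h4 := Submodule.finrank_add_finrank_orthogonal (ℝ ∙ y)
    rw [finrank_span_singleton hy0] at h4
    omega
  refine ⟨Finset.univ.image g, ?_, Finset.card_image_le.trans (by simpa using hcard), ?_⟩
  · intro i hi
    simp only [Finset.coe_image, Finset.coe_univ, Set.image_univ] at hi
    obtain ⟨k, rfl⟩ := hi
    exact hgS k
  · rw [← hsum]
    refine (convex_convexHull ℝ _).sum_mem (fun k _ => (hw k).le) hw1 (fun k _ => ?_)
    refine subset_convexHull _ _ ⟨g k, ?_, hg k⟩
    simp

/-- Many vectors can be signed so as to capture the origin. -/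
lemma capture {E ι : Type*} [NormedAddCommGroup E] [InnerProductSpace ℝ E]
    [FiniteDimensional ℝ E] (x : ι → E) (G : Finset ι) (hG : Module.finrank ℝ E < G.card) :
    ∃ δ : ι → Bool, 0 ∈ convexHull ℝ (sgv x δ '' G) ∧
      0 ∈ convexHull ℝ (sgv x (fun i => !δ i) '' G) := by
  have hdep : ¬ LinearIndepOn ℝ x (G : Set ι) := by
    intro h
    have := LinearIndependent.fintype_card_le_finrank h
    simp at this
    omega
  rw [linearIndepOn_finset_iff] at hdep
  push Not at hdep
  obtain ⟨c, hc, i, hiG, hi⟩ := hdep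
  have hpos : 0 < ∑ i ∈ G, |c i| :=
    Finset.sum_pos' (fun _ _ => abs_nonneg _) ⟨i, hiG, abs_pos.2 hi⟩
  have key : ∀ v : ι → E, (∑ i ∈ G, |c i| • v i = 0) → 0 ∈ convexHull ℝ (v '' G) := by
    intro v hv
    have := (convex_convexHull ℝ (v '' G)).centerMass_mem (t := G) (w := fun i => |c i|) (z := v)
      (fun _ _ => abs_nonneg _) hpos
      (fun i hi => subset_convexHull _ _ ⟨i, hi, rfl⟩)
    rwa [Finset.centerMass, hv, smul_zero] at this
  refine ⟨fun i => decide (0 ≤ c i), key _ ?_, key _ ?_⟩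
  · rw [← hc]
    refine Finset.sum_congr rfl fun i _ => ?_
    by_cases h : 0 ≤ c i
    · simp [sgv, h, abs_of_nonneg h]
    · simp [sgv, h, abs_of_neg (not_le.1 h)]
  · rw [← neg_eq_zero, ← Finset.sum_neg_distrib, ← hc]
    refine Finset.sum_congr rfl fun i _ => ?_
    by_cases h : 0 ≤ c i
    · simp [sgv, h, abs_of_nonneg h]
    · simp [sgv, h, abs_of_neg (not_le.1 h)]

lemma signs {E ι : Type*} [NormedAddCommGroup E] [InnerProductSpace ℝ E]
    [FiniteDimensional ℝ E] [Fintype ι] (x : ι → E) (hD : 2 ≤ Module.finrank ℝ E)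
    (hn : 2 * Module.finrank ℝ E + 1 ≤ Fintype.card ι) :
    ∃ ε : ι → Bool, ∀ j, 0 ∈ convexHull ℝ (sgv x ε '' {j}ᶜ) := by
  by_contra hcon
  push Not at hcon
  let K : (ι → Bool) × ι → Set E := fun p => convexHull ℝ (sgv x p.1 '' {p.2}ᶜ)
  let B : Set ((ι → Bool) × ι) := {p | 0 ∉ K p}
  have hBne : B.Nonempty := by
    obtain ⟨j, hj⟩ := hcon (fun _ => true)
    exact ⟨(fun _ => true, j), hj⟩
  obtain ⟨⟨ε, j⟩, hB, hmin⟩ := Set.exists_min_image B (fun p => Metric.infDist 0 (K p))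
    (Set.toFinite _) hBne
  have hKc : IsCompact (K (ε, j)) := Set.Finite.isCompact_convexHull (𝕜 := ℝ) (Set.toFinite _)
  have : Nontrivial ι := Fintype.one_lt_card_iff_nontrivial.1 (by omega)
  have hKne : (K (ε, j)).Nonempty := by
    obtain ⟨i, hi⟩ := exists_ne j
    exact ⟨_, subset_convexHull _ _ ⟨i, hi, rfl⟩⟩
  obtain ⟨y, hyK, hyd⟩ := hKc.exists_infDist_eq_dist hKne 0
  rw [dist_zero_left] at hyd
  have hy0 : y ≠ 0 := by rintro rfl; exact hB hyK
  have hymin : ∀ q ∈ K (ε, j), ‖y‖ ^ 2 ≤ inner ℝ y q := by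
    intro q hq
    by_contra h
    have := infDist_lt_of_inner_lt (convex_convexHull ℝ _) hyK hq (not_le.1 h)
    exact absurd hyd this.ne
  obtain ⟨F, -, hFc, hyF⟩ := few_points (sgv x ε) {j}ᶜ y hyK hy0 hymin
  have hcc : Fᶜ.card = Fintype.card ι - F.card := Finset.card_compl F
  obtain ⟨δ, hδ1, hδ2⟩ := capture x Fᶜ (by omega)
  -- the key step, for either sign pattern
  have step : ∀ η : ι → Bool, 0 ∈ convexHull ℝ (sgv x η '' (Fᶜ : Finset ι)) →
      ∃ j', ∀ i ∈ Fᶜ, i ≠ j' → ‖y‖ ^ 2 ≤ inner ℝ y (sgv x η i) := by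
    intro η hη
    let ε' : ι → Bool := fun i => if i ∈ F then ε i else η i
    obtain ⟨j', hj'⟩ := hcon ε'
    have hin : ∀ i ∈ F, sgv x ε' i = sgv x ε i := by
      intro i hi; simp [sgv, ε', hi]
    have hout : ∀ i ∈ Fᶜ, sgv x ε' i = sgv x η i := by
      intro i hi; simp [sgv, ε', Finset.mem_compl.1 hi]
    have hj'F : j' ∉ F := by
      intro h
      apply hj'
      refine convexHull_mono ?_ hη
      rintro _ ⟨i, hi, rfl⟩
      refine ⟨i, ?_, hout i hi⟩
      rintro rfl
      exact Finset.mem_compl.1 hi h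
    have hyK' : y ∈ K (ε', j') := by
      refine convexHull_mono ?_ hyF
      rintro _ ⟨i, hi, rfl⟩
      refine ⟨i, ?_, hin i hi⟩
      rintro rfl
      exact hj'F hi
    refine ⟨j', fun i hi hij => ?_⟩
    by_contra h
    have hq : sgv x η i ∈ K (ε', j') :=
      subset_convexHull _ _ ⟨i, hij, hout i hi⟩
    have h1 := infDist_lt_of_inner_lt (convex_convexHull ℝ _) hyK' hq (not_le.1 h)
    have h2 := hmin (ε', j') hj'
    rw [hyd] at h2
    exact absurd h1 (not_lt.2 h2)
  obtain ⟨j₁, h1⟩ := step δ hδ1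
  obtain ⟨j₂, h2⟩ := step _ hδ2
  have : ∃ i ∈ Fᶜ, i ∉ ({j₁, j₂} : Finset ι) := by
    apply Finset.exists_mem_notMem_of_card_lt_card
    have := Finset.card_le_two (a := j₁) (b := j₂)
    omega
  obtain ⟨i, hiF, hi⟩ := this
  simp only [Finset.mem_insert, Finset.mem_singleton, not_or] at hi
  have a1 := h1 i hiF hi.1
  have a2 := h2 i hiF hi.2
  have hneg : sgv x (fun i => !δ i) i = - sgv x δ i := by
    cases h : δ i <;> simp [sgv, h]
  rw [hneg, inner_neg_right] at a2
  have : 0 < ‖y‖ ^ 2 := by positivity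
  linarith

/-- **Larman's theorem on robust Radon partitions**: `v(d) ≤ 2d+3`. Every set of `2d+3`
points in `ℝ^d` can be partitioned into two disjoint sets `X₁, X₂` such that for every
point `p` of the set, the convex hulls of `X₁ \ {p}` and `X₂ \ {p}` still intersect. -/
theorem larman_robust_radon (d : ℕ) (hd : 1 ≤ d)
    (X : Finset (EuclideanSpace ℝ (Fin d))) (hX : X.card = 2 * d + 3) :
    ∃ X₁ X₂ : Finset (EuclideanSpace ℝ (Fin d)),
      Disjoint X₁ X₂ ∧ X₁ ∪ X₂ = X ∧
      ∀ p ∈ X,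
        (convexHull ℝ ((X₁.erase p : Finset (EuclideanSpace ℝ (Fin d))) :
            Set (EuclideanSpace ℝ (Fin d))) ∩
          convexHull ℝ ((X₂.erase p : Finset (EuclideanSpace ℝ (Fin d))) :
            Set (EuclideanSpace ℝ (Fin d)))).Nonempty := by
  let V := EuclideanSpace ℝ (Fin d)
  have hfr : Module.finrank ℝ (WithLp 2 (V × ℝ)) = d + 1 := by
    rw [(WithLp.linearEquiv 2 ℝ (V × ℝ)).finrank_eq, Module.finrank_prod]
    simp [V]
  obtain ⟨ε, hε⟩ := signs (E := WithLp 2 (V × ℝ)) (ι := X)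
    (fun a => WithLp.toLp 2 ((a : V), (1 : ℝ))) (by omega) (by rw [hfr]; simp [hX]; omega)
  let e : V → Bool := fun a => if h : a ∈ X then ε ⟨a, h⟩ else true
  have he : ∀ a : X, e a = ε a := fun a => by simp [e]
  refine ⟨X.filter (fun a => e a = true), X.filter (fun a => ¬ e a = true),
    Finset.disjoint_filter_filter_not _ _ _, Finset.filter_union_filter_not_eq _ _, ?_⟩
  intro p hp
  set A := convexHull ℝ (((X.filter (fun a => e a = true)).erase p : Finset V) : Set V) with hA
  set C := convexHull ℝ (((X.filter (fun a => ¬ e a = true)).erase p : Finset V) : Set V) with hC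
  have h0 := hε ⟨p, hp⟩
  -- invariant set containing the hull
  let Q : Set (WithLp 2 (V × ℝ)) := {z | ∃ s t : ℝ, 0 ≤ s ∧ 0 ≤ t ∧ s + t = 1 ∧ z.snd = s - t ∧
    ∃ u w : V, (s ≠ 0 → u ∈ A) ∧ (t ≠ 0 → w ∈ C) ∧ z.fst = s • u - t • w}
  have comb : ∀ (D : Set V), Convex ℝ D → ∀ (α β s s' : ℝ) (u u' : V), 0 ≤ α → 0 ≤ β → 0 ≤ s →
      0 ≤ s' → (s ≠ 0 → u ∈ D) → (s' ≠ 0 → u' ∈ D) →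
      ∃ u'' : V, (α * s + β * s' ≠ 0 → u'' ∈ D) ∧
        (α * s + β * s') • u'' = (α * s) • u + (β * s') • u' := by
    intro D hD α β s s' u u' hα hβ hs hs' hu hu'
    have p1 := mul_nonneg hα hs
    have p2 := mul_nonneg hβ hs'
    by_cases h1 : α * s = 0
    · refine ⟨u', fun h => hu' ?_, by simp [h1]⟩
      rintro rfl; simp [h1] at h
    by_cases h2 : β * s' = 0
    · refine ⟨u, fun h => hu ?_, by simp [h2]⟩
      rintro rfl; simp at h1
    have hs0 : s ≠ 0 := right_ne_zero_of_mul h1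
    have hs0' : s' ≠ 0 := right_ne_zero_of_mul h2
    have hpos : 0 < α * s + β * s' := by
      have := lt_of_le_of_ne p1 (Ne.symm h1); linarith
    refine ⟨(α * s / (α * s + β * s')) • u + (β * s' / (α * s + β * s')) • u', fun _ =>
      hD (hu hs0) (hu' hs0') (by positivity) (by positivity) (by field_simp), ?_⟩
    rw [smul_add, smul_smul, smul_smul, mul_div_cancel₀ _ hpos.ne', mul_div_cancel₀ _ hpos.ne']
  have hQ : Convex ℝ Q := by
    rintro z ⟨s, t, hs, ht, hst, hz2, u, w, hu, hw, hz1⟩ z' ⟨s', t', hs', ht', hst', hz2', u', w',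
      hu', hw', hz1'⟩ α β hα hβ hαβ
    obtain ⟨u'', hu'', e1⟩ := comb A (convex_convexHull ℝ _) α β s s' u u' hα hβ hs hs' hu hu'
    obtain ⟨w'', hw'', e2⟩ := comb C (convex_convexHull ℝ _) α β t t' w w' hα hβ ht ht' hw hw'
    refine ⟨α * s + β * s', α * t + β * t', by positivity, by positivity, ?_, ?_, u'', w'', hu'',
      hw'', ?_⟩
    · calc _ = α * (s + t) + β * (s' + t') := by ring
        _ = 1 := by rw [hst, hst']; linarith
    · simp [hz2, hz2']; ring
    · rw [e1, e2]; simp [hz1, hz1', smul_sub, smul_smul]; abel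
  have hsub : convexHull ℝ (sgv (fun a : X => WithLp.toLp 2 ((a : V), (1 : ℝ))) ε ''
      {(⟨p, hp⟩ : X)}ᶜ) ⊆ Q := by
    refine convexHull_min ?_ hQ
    rintro _ ⟨⟨a, ha⟩, hap, rfl⟩
    have hap' : a ≠ p := fun h => hap (by simp [h])
    have hea := he ⟨a, ha⟩
    simp only at hea
    by_cases h : ε ⟨a, ha⟩ = true
    · refine ⟨1, 0, by norm_num, le_rfl, by norm_num, by simp [sgv, h], a, 0, fun _ => ?_,
        by simp, by simp [sgv, h]⟩
      exact subset_convexHull _ _ (by simp [hap', ha, hea, h])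
    · refine ⟨0, 1, le_rfl, by norm_num, by norm_num, by simp [sgv, h], 0, a, by simp,
        fun _ => ?_, by simp [sgv, h]⟩
      exact subset_convexHull _ _ (by simp [hap', ha, hea, h])
  obtain ⟨s, t, hs, ht, hst, hz2, u, w, hu, hw, hz1⟩ := hsub h0
  simp only [WithLp.zero_snd, WithLp.zero_fst] at hz1 hz2
  have hs2 : s = 1 / 2 := by linarith
  have ht2 : t = 1 / 2 := by linarith
  have huw : u = w := by
    rw [hs2, ht2, ← smul_sub] at hz1
    have := (smul_eq_zero.1 hz1.symm).resolve_left (by norm_num)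
    exact sub_eq_zero.1 this
  refine ⟨u, hu (by rw [hs2]; norm_num), ?_⟩
  rw [huw]
  exact hw (by rw [ht2]; norm_num)
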